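/- arXiv:1905.04801 — 3 statements merged into one kernel-verified Lean document; each statement's English description precedes it below -/
import Mathlib

section
/- Let X be a complex Banach space, U a bounded invertible operator on X, A a bounded operator on X, and γ ∈ ℂ with |γ| = 1 which is not a root of unity (γⁿ ≠ 1 for all n ≥ 1), such that U A U⁻¹ = γ A. Let w be a bounded operator on X commuting with A, set T = w U, and assume A has a left inverse S ∈ L(X) with S A = I. Then the sets σ(T), σ_ap(T), and σ₂(T) are rotation invariant: if λ belongs to one of these sets and μ ∈ ℂ with |μ| = 1, then μλ belongs to the same set. -/
open Filter Topology

/-- The approximate point spectrum of a bounded operator. -/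
def approxPointSpectrum {X : Type*} [NormedAddCommGroup X] [NormedSpace ℂ X]
    (T : X →L[ℂ] X) : Set ℂ :=
  {l : ℂ | ∃ x : ℕ → X, (∀ n, ‖x n‖ = 1) ∧
    Tendsto (fun n => ‖T (x n) - l • x n‖) atTop (nhds 0)}

/-- A sequence in a normed space is singular if it has no norm-convergent subsequence. -/
def IsSingularSeq {X : Type*} [NormedAddCommGroup X] (x : ℕ → X) : Prop :=
  ¬ ∃ (y : X) (φ : ℕ → ℕ), StrictMono φ ∧ Tendsto (fun n => x (φ n)) atTop (nhds y)

/-- `σ₂(T)`: the set of `l : ℂ` admitting a singular sequence of unit almost-eigenvectors. -/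
def sigma2 {X : Type*} [NormedAddCommGroup X] [NormedSpace ℂ X]
    (T : X →L[ℂ] X) : Set ℂ :=
  {l : ℂ | ∃ x : ℕ → X, (∀ n, ‖x n‖ = 1) ∧ IsSingularSeq x ∧
    Tendsto (fun n => ‖T (x n) - l • x n‖) atTop (nhds 0)}

/-- A subset of `ℂ` is rotation invariant if it is stable under multiplication by
unimodular numbers. -/
def RotationInvariant (s : Set ℂ) : Prop :=
  ∀ l ∈ s, ∀ μ : ℂ, ‖μ‖ = 1 → μ * l ∈ s

theorem rotInv_of_closed {s : Set ℂ} (hs : IsClosed s) {γ : ℂ} (hγ : ‖γ‖ = 1)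
    (hroot : ∀ n : ℕ, 1 ≤ n → γ ^ n ≠ 1) (h : ∀ l ∈ s, γ * l ∈ s) : RotationInvariant s := by
  have h1 : (0:ℝ) < 1 := one_pos
  have : Fact ((0:ℝ) < 1) := ⟨one_pos⟩
  let g : Circle := ⟨γ, mem_sphere_zero_iff_norm.2 hγ⟩
  have hdense : DenseRange (fun n : ℕ => g ^ n) := by
    rw [← denseRange_zpow_iff_pow]
    obtain ⟨a, ha⟩ := (AddCircle.homeomorphCircle (one_ne_zero (α := ℝ))).surjective g
    have hd : DenseRange (· • a : ℤ → AddCircle (1:ℝ)) := by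
      rw [AddCircle.denseRange_zsmul_iff, addOrderOf_eq_zero_iff']
      intro n hn h0
      apply hroot n hn
      have : g ^ n = 1 := by
        rw [← ha, AddCircle.homeomorphCircle_apply, ← AddCircle.toCircle_nsmul, h0,
          AddCircle.toCircle_zero]
      have h2 := congrArg (fun z : Circle => (z : ℂ)) this
      rwa [Circle.coe_pow, Circle.coe_one] at h2
    have := (AddCircle.homeomorphCircle (one_ne_zero (α := ℝ))).surjective.denseRange.comp hd
      (AddCircle.homeomorphCircle (one_ne_zero (α := ℝ))).continuous
    convert this using 2 with n
    simp only [Function.comp, AddCircle.homeomorphCircle_apply, AddCircle.toCircle_zsmul]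
    rw [← AddCircle.homeomorphCircle_apply (one_ne_zero (α := ℝ)), ha]
  intro l hl μ hμ
  have hcl : IsClosed {z : Circle | (z : ℂ) * l ∈ s} :=
    hs.preimage (by fun_prop : Continuous fun z : Circle => (z : ℂ) * l)
  have hpow : ∀ n : ℕ, γ ^ n * l ∈ s := by
    intro n
    induction n with
    | zero => simpa using hl
    | succ k ih => rw [pow_succ', mul_assoc]; exact h _ ih
  have := hdense.induction_on (p := fun z : Circle => (z : ℂ) * l ∈ s)
    ⟨μ, mem_sphere_zero_iff_norm.2 hμ⟩ hcl (fun n => by rw [Circle.coe_pow]; exact hpow n)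
  exact this

section
variable {X : Type*} [NormedAddCommGroup X] [NormedSpace ℂ X]

theorem approx_scale (T A S : X →L[ℂ] X) (γ l : ℂ) (hγ : ‖γ‖ = 1)
    (hTA : ∀ x, T (A x) = γ • A (T x)) (hSA : ∀ x, S (A x) = x)
    (x : ℕ → X) (hx : ∀ n, ‖x n‖ = 1)
    (hlim : Tendsto (fun n => ‖T (x n) - l • x n‖) atTop (nhds 0)) :
    ∃ y : ℕ → X, (∀ n, ‖y n‖ = 1) ∧ (IsSingularSeq x → IsSingularSeq y) ∧
      Tendsto (fun n => ‖T (y n) - (γ * l) • y n‖) atTop (nhds 0) := by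
  have hlow : ∀ n, 1 ≤ ‖S‖ * ‖A (x n)‖ := fun n => by
    have := S.le_opNorm (A (x n))
    rwa [hSA, hx] at this
  have hpos : ∀ n, 0 < ‖A (x n)‖ := fun n => by
    rcases (norm_nonneg (A (x n))).eq_or_lt with h | h
    · have := hlow n
      rw [← h] at this
      norm_num at this
    · exact h
  refine ⟨fun n => ((‖A (x n)‖⁻¹ : ℝ) : ℂ) • A (x n), ?_, ?_, ?_⟩
  · intro n
    rw [norm_smul, Complex.norm_real, norm_inv, norm_norm, inv_mul_cancel₀ (hpos n).ne']
  · intro hsing ⟨y, φ, hφ, hy⟩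
    apply hsing
    have hb : ∀ n, ‖A (x (φ n))‖ ∈ Set.Icc (0:ℝ) ‖A‖ := fun n =>
      ⟨norm_nonneg _, by simpa [hx] using A.le_opNorm (x (φ n))⟩
    obtain ⟨r, -, ψ, hψ, hr⟩ := isCompact_Icc.tendsto_subseq hb
    refine ⟨S ((r : ℂ) • y), φ ∘ ψ, hφ.comp hψ, ?_⟩
    have h2 := hy.comp hψ.tendsto_atTop
    have hr' : Tendsto (fun n => ((‖A (x (φ (ψ n)))‖ : ℝ) : ℂ)) atTop (nhds (r : ℂ)) :=
      (Complex.continuous_ofReal.tendsto r).comp hr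
    have h3 := (S.continuous.tendsto _).comp (hr'.smul h2)
    refine h3.congr fun n => ?_
    simp only [Function.comp]
    rw [smul_smul, ← Complex.ofReal_mul, mul_inv_cancel₀ (hpos _).ne']
    simp [hSA]
  · have h0 : Tendsto (fun n => (‖S‖ * ‖A‖) * ‖T (x n) - l • x n‖) atTop (nhds 0) := by
      simpa using hlim.const_mul (‖S‖ * ‖A‖)
    refine squeeze_zero (fun _ => norm_nonneg _) (fun n => ?_) h0
    have he : T (((‖A (x n)‖⁻¹ : ℝ) : ℂ) • A (x n)) -
        (γ * l) • (((‖A (x n)‖⁻¹ : ℝ) : ℂ) • A (x n)) =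
        (((‖A (x n)‖⁻¹ : ℝ) : ℂ) * γ) • A (T (x n) - l • x n) := by
      simp only [map_smul, map_sub, hTA]
      module
    rw [he, norm_smul, norm_mul, hγ, mul_one, Complex.norm_real, norm_inv, norm_norm, mul_assoc]
    have hi : ‖A (x n)‖⁻¹ ≤ ‖S‖ := by
      rw [inv_le_iff_one_le_mul₀ (hpos n)]
      exact hlow n
    exact mul_le_mul hi (A.le_opNorm _) (norm_nonneg _) (norm_nonneg _)

theorem perturb (T : X →L[ℂ] X) (l l' : ℂ) (x : X) :
    ‖T x - l • x‖ ≤ ‖T x - l' • x‖ + ‖l' - l‖ * ‖x‖ := by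
  have : T x - l • x = (T x - l' • x) + (l' - l) • x := by module
  rw [this, ← norm_smul]
  exact norm_add_le _ _

/-- Generic normalisation: if there is no lower bound on a subspace, extract unit vectors. -/
theorem exists_seq_of_not_bdd (T : X →L[ℂ] X) (l : ℂ) (M : Submodule ℂ X)
    (h : ¬ ∃ c > (0:ℝ), ∀ x ∈ M, ‖x‖ ≤ c * ‖T x - l • x‖) :
    ∃ x : ℕ → X, (∀ n, x n ∈ M) ∧ (∀ n, ‖x n‖ = 1) ∧
      Tendsto (fun n => ‖T (x n) - l • x n‖) atTop (nhds 0) := by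
  push Not at h
  choose z hzM hz using fun n : ℕ => h ((n : ℝ) + 1) (by positivity)
  have hpos : ∀ n, 0 < ‖z n‖ := fun n => lt_of_le_of_lt (by positivity) (hz n)
  refine ⟨fun n => ((‖z n‖⁻¹ : ℝ) : ℂ) • z n, fun n => M.smul_mem _ (hzM n), fun n => ?_, ?_⟩
  · rw [norm_smul, Complex.norm_real, norm_inv, norm_norm, inv_mul_cancel₀ (hpos n).ne']
  · refine squeeze_zero (fun _ => norm_nonneg _) (fun n => ?_)
      (tendsto_one_div_add_atTop_nhds_zero_nat (𝕜 := ℝ))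
    have he : T (((‖z n‖⁻¹ : ℝ) : ℂ) • z n) - l • (((‖z n‖⁻¹ : ℝ) : ℂ) • z n) =
        ((‖z n‖⁻¹ : ℝ) : ℂ) • (T (z n) - l • z n) := by
      simp only [map_smul]
      module
    rw [he, norm_smul, Complex.norm_real, norm_inv, norm_norm, inv_mul_eq_div,
      div_le_div_iff₀ (hpos n) (by positivity)]
    linarith [hz n]

theorem notMem_ap_iff (T : X →L[ℂ] X) (l : ℂ) :
    l ∉ approxPointSpectrum T ↔ ∃ c > (0:ℝ), ∀ x, ‖x‖ ≤ c * ‖T x - l • x‖ := by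
  constructor
  · intro h
    by_contra hc
    apply h
    obtain ⟨x, -, h1, h2⟩ := exists_seq_of_not_bdd T l ⊤ (by simpa using hc)
    exact ⟨x, h1, h2⟩
  · rintro ⟨c, hc, h⟩ ⟨x, hx, hlim⟩
    have h0 := hlim.const_mul c
    have : (1:ℝ) ≤ c * 0 := ge_of_tendsto' h0 fun n => by simpa [hx] using h (x n)
    norm_num at this

theorem perturb_bound {T : X →L[ℂ] X} {l l' : ℂ} {c : ℝ} (hc : 0 < c)
    (hl : ‖l' - l‖ < (2 * c)⁻¹) (F : X → ℝ) (h : ∀ x, ‖x‖ ≤ c * ‖T x - l • x‖ + F x) (x : X) :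
    ‖x‖ ≤ (2 * c) * ‖T x - l' • x‖ + 2 * F x := by
  have h1 := h x
  have h2 := perturb T l l' x
  have h3 : c * (‖l' - l‖ * ‖x‖) ≤ c * ((2 * c)⁻¹ * ‖x‖) := by gcongr
  have h4 : c * ((2 * c)⁻¹ * ‖x‖) = ‖x‖ / 2 := by field_simp
  have h5 := mul_le_mul_of_nonneg_left h2 hc.le
  nlinarith

theorem isClosed_ap (T : X →L[ℂ] X) : IsClosed (approxPointSpectrum T) := by
  rw [← isOpen_compl_iff, Metric.isOpen_iff]
  intro l hl
  obtain ⟨c, hc, h⟩ := (notMem_ap_iff T l).1 hl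
  refine ⟨(2 * c)⁻¹, by positivity, fun l' hl' => (notMem_ap_iff T l').2 ⟨2 * c, by positivity, ?_⟩⟩
  rw [Metric.mem_ball, dist_eq_norm] at hl'
  intro x
  simpa using perturb_bound hc hl' (fun _ => 0) (by simpa using h) x

theorem notMem_sigma2_of [CompleteSpace X] {T : X →L[ℂ] X} {l : ℂ} {c : ℝ}
    {Y : Submodule ℂ X} [FiniteDimensional ℂ Y] (F : X →L[ℂ] Y)
    (h : ∀ x, ‖x‖ ≤ c * ‖T x - l • x‖ + ‖F x‖) : l ∉ sigma2 T := by
  rintro ⟨x, hx, hsing, hlim⟩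
  apply hsing
  have : ProperSpace Y := FiniteDimensional.proper ℂ Y
  have hb : ∀ n, F (x n) ∈ Metric.closedBall (0 : Y) ‖F‖ := fun n => by
    simpa [hx] using F.le_opNorm (x n)
  obtain ⟨y, -, φ, hφ, hy⟩ := (isCompact_closedBall (0 : Y) ‖F‖).tendsto_subseq hb
  have hcau : CauchySeq (fun n => x (φ n)) := by
    have hlim0 : Tendsto (fun n => T (x (φ n)) - l • x (φ n)) atTop (nhds 0) :=
      tendsto_zero_iff_norm_tendsto_zero.2 (hlim.comp hφ.tendsto_atTop)
    have c1 := cauchySeq_iff_tendsto_dist_atTop_0.1 hlim0.cauchySeq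
    have c2 := cauchySeq_iff_tendsto_dist_atTop_0.1 hy.cauchySeq
    rw [cauchySeq_iff_tendsto_dist_atTop_0]
    have c3 := (c1.const_mul c).add c2
    simp only [mul_zero, add_zero] at c3
    refine squeeze_zero (fun _ => dist_nonneg) (fun p => ?_) c3
    have := h (x (φ p.1) - x (φ p.2))
    simp only [Function.comp, dist_eq_norm]
    rw [← map_sub]
    have he : T (x (φ p.1) - x (φ p.2)) - l • (x (φ p.1) - x (φ p.2)) =
        (T (x (φ p.1)) - l • x (φ p.1)) - (T (x (φ p.2)) - l • x (φ p.2)) := by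
      rw [map_sub]
      module
    rwa [he] at this
  obtain ⟨z, hz⟩ := cauchySeq_tendsto_of_complete hcau
  exact ⟨z, φ, hφ, hz⟩

theorem exists_of_notMem_sigma2 (T : X →L[ℂ] X) (l : ℂ) (h : l ∉ sigma2 T) :
    ∃ (Y : Submodule ℂ X) (_ : FiniteDimensional ℂ Y) (F : X →L[ℂ] Y), ∃ c > (0:ℝ),
      ∀ x, ‖x‖ ≤ c * ‖T x - l • x‖ + ‖F x‖ := by
  have hconv : ∀ x : ℕ → X, (∀ n, ‖x n‖ = 1) →
      Tendsto (fun n => ‖T (x n) - l • x n‖) atTop (nhds 0) →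
      ∃ (y : X) (φ : ℕ → ℕ), StrictMono φ ∧ Tendsto (fun n => x (φ n)) atTop (nhds y) := by
    intro x hx hl
    by_contra hc
    exact h ⟨x, hx, hc, hl⟩
  let B : X →L[ℂ] X := T - l • ContinuousLinearMap.id ℂ X
  have hB : ∀ x, B x = T x - l • x := fun x => by simp [B]
  let Y : Submodule ℂ X := LinearMap.ker (B : X →ₗ[ℂ] X)
  have hYmem : ∀ x, x ∈ Y ↔ B x = 0 := fun x => LinearMap.mem_ker
  have hYcl : IsClosed (Y : Set X) := B.isClosed_ker
  have hfin : FiniteDimensional ℂ Y := by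
    apply FiniteDimensional.of_isCompact_closedBall₀ ℂ (V := Y) one_pos
    have hsph : IsCompact (Metric.sphere (0 : Y) 1) := by
      rw [isCompact_iff_isSeqCompact]
      intro x hx
      have hx1 : ∀ n, ‖(x n : X)‖ = 1 := fun n => by simpa using hx n
      have hz : ∀ n, T (x n : X) - l • (x n : X) = 0 := fun n => by
        rw [← hB]; exact (hYmem _).1 (x n).2
      obtain ⟨y, φ, hφ, hy⟩ := hconv (fun n => (x n : X)) hx1 (by simp [hz])
      have hyY : y ∈ Y := hYcl.mem_of_tendsto hy (Eventually.of_forall fun n => (x (φ n)).2)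
      have hy1 : ‖y‖ = 1 := tendsto_nhds_unique hy.norm (by simp [hx1])
      exact ⟨⟨y, hyY⟩, by simpa using hy1, φ, hφ, tendsto_subtype_rng.2 hy⟩
    have himg := ((isCompact_Icc (a := (0:ℝ)) (b := 1)).prod hsph).image
      (f := fun p : ℝ × Y => (p.1 : ℂ) • p.2)
      ((Complex.continuous_ofReal.comp continuous_fst).smul continuous_snd)
    refine (himg.union (isCompact_singleton (x := (0 : Y)))).of_isClosed_subset
      Metric.isClosed_closedBall fun z hz => ?_
    by_cases h0 : z = 0
    · exact Or.inr h0
    · left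
      have hn : ‖z‖ ≠ 0 := norm_ne_zero_iff.2 h0
      refine ⟨(‖z‖, ((‖z‖⁻¹ : ℝ) : ℂ) • z), ⟨⟨norm_nonneg _, by simpa using hz⟩, ?_⟩, ?_⟩
      · rw [mem_sphere_zero_iff_norm, norm_smul, Complex.norm_real, norm_inv, norm_norm,
          inv_mul_cancel₀ hn]
      · simp only
        rw [smul_smul, ← Complex.ofReal_mul, mul_inv_cancel₀ hn, Complex.ofReal_one, one_smul]
  refine ⟨Y, hfin, ?_⟩
  obtain ⟨P, hP⟩ := Submodule.ClosedComplemented.of_finiteDimensional Y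
  let M : Submodule ℂ X := LinearMap.ker (P : X →ₗ[ℂ] Y)
  have hbdd : ∃ c > (0:ℝ), ∀ x ∈ M, ‖x‖ ≤ c * ‖T x - l • x‖ := by
    by_contra hc
    obtain ⟨x, hxM, hx, hlim⟩ := exists_seq_of_not_bdd T l M hc
    obtain ⟨y, φ, hφ, hy⟩ := hconv x hx hlim
    have hy1 : ‖y‖ = 1 := tendsto_nhds_unique hy.norm (by simp [hx])
    have hPy : P y = 0 := by
      refine tendsto_nhds_unique ((P.continuous.tendsto y).comp hy) ?_
      have : ∀ n, P (x (φ n)) = 0 := fun n => hxM _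
      simp [Function.comp_def, this]
    have hBy : B y = 0 := by
      refine tendsto_nhds_unique ((B.continuous.tendsto y).comp hy) ?_
      refine tendsto_zero_iff_norm_tendsto_zero.2 ?_
      simpa [Function.comp_def, hB] using hlim.comp hφ.tendsto_atTop
    have := hP ⟨y, (hYmem y).2 hBy⟩
    rw [hPy] at this
    have : y = 0 := (congrArg Subtype.val this).symm
    rw [this] at hy1
    norm_num at hy1
  obtain ⟨c, hc, hb⟩ := hbdd
  refine ⟨P, c, hc, fun x => ?_⟩
  have hm : x - P x ∈ M := by
    change P (x - P x) = 0
    rw [map_sub, hP, sub_self]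
  have h1 := hb _ hm
  have h2 : B (P x : X) = 0 := (hYmem _).1 (P x).2
  rw [← hB, map_sub, h2, sub_zero, hB] at h1
  have h3 : ‖x‖ ≤ ‖x - P x‖ + ‖(P x : X)‖ := by
    simpa using norm_add_le (x - P x) (P x : X)
  have h4 : ‖(P x : X)‖ = ‖P x‖ := rfl
  linarith

theorem isClosed_sigma2 [CompleteSpace X] (T : X →L[ℂ] X) : IsClosed (sigma2 T) := by
  rw [← isOpen_compl_iff, Metric.isOpen_iff]
  intro l hl
  obtain ⟨Y, hY, F, c, hc, h⟩ := exists_of_notMem_sigma2 T l hl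
  refine ⟨(2 * c)⁻¹, by positivity, fun l' hl' => ?_⟩
  rw [Metric.mem_ball, dist_eq_norm] at hl'
  refine notMem_sigma2_of (c := 2 * c) ((2 : ℂ) • F) fun x => ?_
  have := perturb_bound hc hl' (fun x => ‖F x‖) h x
  simpa [norm_smul] using this

theorem isUnit_of_close [CompleteSpace X] {T : X →L[ℂ] X} {l l' : ℂ} {c : ℝ} (hc : 0 < c)
    (hl : ‖l' - l‖ < (2 * c)⁻¹) (h : ∀ x, ‖x‖ ≤ c * ‖T x - l • x‖)
    (hu : l' ∉ spectrum ℂ T) : l ∉ spectrum ℂ T := by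
  rw [spectrum.notMem_iff] at hu ⊢
  obtain ⟨u, hu⟩ := hu
  have hR : ‖((u⁻¹ : (X →L[ℂ] X)ˣ) : X →L[ℂ] X)‖ ≤ 2 * c := by
    refine ContinuousLinearMap.opNorm_le_bound _ (by positivity) fun y => ?_
    have h1 := perturb_bound hc hl (fun _ => 0) (by simpa using h)
      (((u⁻¹ : (X →L[ℂ] X)ˣ) : X →L[ℂ] X) y)
    have h2 : (u : X →L[ℂ] X) (((u⁻¹ : (X →L[ℂ] X)ˣ) : X →L[ℂ] X) y) = y := by
      rw [← mul_apply_eq_comp, Units.mul_inv, one_apply_eq_self]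
    rw [hu] at h2
    have h3 : T (((u⁻¹ : (X →L[ℂ] X)ˣ) : X →L[ℂ] X) y) -
        l' • (((u⁻¹ : (X →L[ℂ] X)ˣ) : X →L[ℂ] X) y) = -y := by
      conv_rhs => rw [← h2]
      simp [Algebra.algebraMap_eq_smul_one]
    rw [h3, norm_neg] at h1
    simpa using h1
  have hlt : ‖(l' - l) • ((u⁻¹ : (X →L[ℂ] X)ˣ) : X →L[ℂ] X)‖ < 1 := by
    rw [norm_smul]
    calc _ ≤ ‖l' - l‖ * (2 * c) := by gcongr
      _ < (2 * c)⁻¹ * (2 * c) := by gcongr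
      _ = 1 := inv_mul_cancel₀ (by positivity)
  have hk := u.isUnit.mul (isUnit_one_sub_of_norm_lt_one hlt)
  convert hk using 1
  rw [mul_sub, mul_one, mul_smul_comm, Units.mul_inv, hu]
  simp only [Algebra.algebraMap_eq_smul_one]
  module

theorem frontier_subset_ap [CompleteSpace X] (T : X →L[ℂ] X) :
    frontier (spectrum ℂ T) ⊆ approxPointSpectrum T := by
  intro l hl
  by_contra hn
  obtain ⟨c, hc, h⟩ := (notMem_ap_iff T l).1 hn
  have hmem : l ∈ spectrum ℂ T := (spectrum.isClosed (𝕜 := ℂ) T).frontier_subset hl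
  have hcl : l ∈ closure (spectrum ℂ T)ᶜ := by
    rw [frontier_eq_closure_inter_closure] at hl
    exact hl.2
  obtain ⟨l', hl', hd⟩ := Metric.mem_closure_iff.1 hcl (2 * c)⁻¹ (by positivity)
  rw [dist_comm, dist_eq_norm] at hd
  exact isUnit_of_close hc hd h hl' hmem

theorem ap_subset_spectrum [CompleteSpace X] (T : X →L[ℂ] X) :
    approxPointSpectrum T ⊆ spectrum ℂ T := by
  intro l hl
  by_contra hn
  rw [spectrum.notMem_iff] at hn
  obtain ⟨u, hu⟩ := hn
  refine (notMem_ap_iff T l).2 ⟨‖((u⁻¹ : (X →L[ℂ] X)ˣ) : X →L[ℂ] X)‖ + 1, by positivity, fun x => ?_⟩ hl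
  have h2 : ((u⁻¹ : (X →L[ℂ] X)ˣ) : X →L[ℂ] X) ((u : X →L[ℂ] X) x) = x := by
    rw [← mul_apply_eq_comp, Units.inv_mul, one_apply_eq_self]
  have h3 := ((u⁻¹ : (X →L[ℂ] X)ˣ) : X →L[ℂ] X).le_opNorm ((u : X →L[ℂ] X) x)
  have h4 : ‖(u : X →L[ℂ] X) x‖ = ‖T x - l • x‖ := by
    rw [hu, norm_sub_rev]
    simp [Algebra.algebraMap_eq_smul_one]
  rw [h2, h4] at h3
  nlinarith [norm_nonneg (T x - l • x)]

theorem rotInv_spectrum [CompleteSpace X] (T : X →L[ℂ] X)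
    (h : RotationInvariant (approxPointSpectrum T)) : RotationInvariant (spectrum ℂ T) := by
  intro l hl μ hμ
  by_contra hn
  have hpre : IsPreconnected (Metric.sphere (0:ℂ) ‖l‖) :=
    isPreconnected_sphere (by simp) 0 _
  have hne : (Metric.sphere (0:ℂ) ‖l‖ ∩ frontier (spectrum ℂ T)).Nonempty := by
    by_contra he
    rw [Set.not_nonempty_iff_eq_empty] at he
    have hsub : Metric.sphere (0:ℂ) ‖l‖ ⊆ interior (spectrum ℂ T) ∪ (spectrum ℂ T)ᶜ := by
      intro z hz
      by_cases hzs : z ∈ spectrum ℂ T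
      · left
        by_contra hi
        have : z ∈ Metric.sphere (0:ℂ) ‖l‖ ∩ frontier (spectrum ℂ T) :=
          ⟨hz, subset_closure hzs, hi⟩
        rw [he] at this
        exact this
      · exact Or.inr hzs
    have hl0 : l ∈ Metric.sphere (0:ℂ) ‖l‖ := by simp
    obtain ⟨z, -, hz1, hz2⟩ := hpre _ _ isOpen_interior
      (spectrum.isClosed (𝕜 := ℂ) T).isOpen_compl hsub
      ⟨l, hl0, (hsub hl0).resolve_right (fun hh => hh hl)⟩
      ⟨μ * l, by simp [hμ], hn⟩
    exact hz2 (interior_subset hz1)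
  obtain ⟨z, hz, hzf⟩ := hne
  have hzn : ‖z‖ = ‖l‖ := by simpa using hz
  have hza := frontier_subset_ap T hzf
  apply hn
  by_cases h0 : l = 0
  · rw [h0, mul_zero, ← h0]; exact hl
  · have hz0 : z ≠ 0 := by
      rw [← norm_ne_zero_iff, hzn]; simpa using h0
    have := h z hza (μ * l / z) (by
      rw [norm_div, norm_mul, hμ, hzn, one_mul, div_self]; simpa using h0)
    rw [div_mul_cancel₀ _ hz0] at this
    exact ap_subset_spectrum T this

end

theorem statement_2 {X : Type*} [NormedAddCommGroup X] [NormedSpace ℂ X] [CompleteSpace X]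
    (U V A w S T : X →L[ℂ] X) (γ : ℂ)
    (hUV : U * V = 1) (hVU : V * U = 1) (hγ : ‖γ‖ = 1)
    (hroot : ∀ n : ℕ, 1 ≤ n → γ ^ n ≠ 1)
    (hA : U * A * V = γ • A)
    (hwA : w * A = A * w)
    (hT : T = w * U)
    (hS : S * A = 1) :
    RotationInvariant (spectrum ℂ T) ∧ RotationInvariant (approxPointSpectrum T) ∧
      RotationInvariant (sigma2 T) := by
  have hTA' : T * A = γ • (A * T) := by
    have h1 : U * A = γ • (A * U) := by
      calc U * A = U * A * (V * U) := by rw [hVU, mul_one]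
        _ = (U * A * V) * U := by simp only [mul_assoc]
        _ = γ • (A * U) := by rw [hA, smul_mul_assoc]
    rw [hT, mul_assoc, h1, mul_smul_comm, ← mul_assoc, hwA, mul_assoc]
  have hTA : ∀ x, T (A x) = γ • A (T x) := fun x => by
    simpa using congrArg (fun f : X →L[ℂ] X => f x) hTA'
  have hSA : ∀ x, S (A x) = x := fun x => by
    simpa using congrArg (fun f : X →L[ℂ] X => f x) hS
  have hap : RotationInvariant (approxPointSpectrum T) := by
    refine rotInv_of_closed (isClosed_ap T) hγ hroot ?_
    rintro l ⟨x, hx, hlim⟩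
    obtain ⟨y, h1, -, h3⟩ := approx_scale T A S γ l hγ hTA hSA x hx hlim
    exact ⟨y, h1, h3⟩
  refine ⟨rotInv_spectrum T hap, hap, ?_⟩
  refine rotInv_of_closed (isClosed_sigma2 T) hγ hroot ?_
  rintro l ⟨x, hx, hsing, hlim⟩
  obtain ⟨y, h1, h2, h3⟩ := approx_scale T A S γ l hγ hTA hSA x hx hlim
  exact ⟨y, h1, h2 hsing, h3⟩
end

section
/- Let X be a complex Banach space and U a bounded invertible operator on X which is rotation-like, i.e. there exist a nonzero bounded operator A on X and γ ∈ ℂ with |γ| = 1, γ ≠ 1, such that U A U⁻¹ = γ A. Let 𝒜 = {A ∈ L(X) : A ≠ 0 and U A U⁻¹ = γ_A A for some γ_A ∈ ℂ with |γ_A| = 1}, and let Γ be the subgroup of the unit circle generated by the numbers γ_A, A ∈ 𝒜. Let w be a bounded operator on X commuting with every element of 𝒜, and assume that T = w U is invertible in L(X). Assume further: (B) for every A ∈ 𝒜 and every n ∈ ℕ, Aⁿ ≠ 0; (C) Γ is infinite. Then there exists a real number t > 0 such that the entire circle {λ ∈ ℂ : |λ| = t} is contained in σ(T). -/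
open Filter Topology

/-- The set `𝒜` of nonzero bounded operators `A` with `U A U⁻¹ = γ • A` for some
unimodular `γ` (here `V = U⁻¹`). -/
def rotOperatorSet {X : Type*} [NormedAddCommGroup X] [NormedSpace ℂ X]
    (U V : X →L[ℂ] X) : Set (X →L[ℂ] X) :=
  {A | A ≠ 0 ∧ ∃ γ : ℂ, ‖γ‖ = 1 ∧ U * A * V = γ • A}

/-- The set of unimodular numbers `γ` appearing in the relations `U A U⁻¹ = γ • A`,
viewed as units of `ℂ`. -/
def rotGammaSet {X : Type*} [NormedAddCommGroup X] [NormedSpace ℂ X]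
    (U V : X →L[ℂ] X) : Set ℂˣ :=
  {u : ℂˣ | ‖(u : ℂ)‖ = 1 ∧ ∃ A : X →L[ℂ] X, A ≠ 0 ∧ U * A * V = (u : ℂ) • A}

section Helpers

variable {E : Type*} [NormedRing E] [NormedAlgebra ℂ E] [CompleteSpace E]

theorem rot_intertwine_pow {A T : E} {b : ℂ} (h : A * T = b • (T * A)) (i : ℕ) :
    A ^ i * T = b ^ i • (T * A ^ i) := by
  induction i with
  | zero => simp
  | succ i ih =>
    rw [pow_succ, mul_assoc, h, mul_smul_comm, ← mul_assoc, ih, smul_mul_assoc, smul_smul,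
      mul_assoc, pow_succ, mul_comm]

theorem rot_resolvent_intertwine {A T : E} {b : ℂ} (h : A * T = b • (T * A)) (i : ℕ) {z : ℂ}
    (hz : z ∈ resolventSet ℂ T) (hz' : b ^ i * z ∈ resolventSet ℂ T) :
    resolvent T z * A ^ i = b ^ i • (A ^ i * resolvent T (b ^ i * z)) := by
  have e : A ^ i * (algebraMap ℂ E (b ^ i * z) - T) = b ^ i • ((algebraMap ℂ E z - T) * A ^ i) := by
    rw [mul_sub, sub_mul, rot_intertwine_pow h, smul_sub, Algebra.algebraMap_eq_smul_one,
      Algebra.algebraMap_eq_smul_one, mul_smul_comm, smul_mul_assoc, mul_one, one_mul, smul_smul]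
  have h1 : resolvent T z * (algebraMap ℂ E z - T) = 1 := Ring.inverse_mul_cancel _ hz
  have h2 : (algebraMap ℂ E (b ^ i * z) - T) * resolvent T (b ^ i * z) = 1 :=
    Ring.mul_inverse_cancel _ hz'
  calc resolvent T z * A ^ i
      = resolvent T z * (A ^ i * ((algebraMap ℂ E (b ^ i * z) - T) * resolvent T (b ^ i * z))) := by
        rw [h2, mul_one]
    _ = resolvent T z * ((A ^ i * (algebraMap ℂ E (b ^ i * z) - T)) * resolvent T (b ^ i * z)) := by
        rw [mul_assoc]
    _ = b ^ i • ((resolvent T z * (algebraMap ℂ E z - T)) * A ^ i * resolvent T (b ^ i * z)) := by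
        rw [e, smul_mul_assoc, mul_smul_comm]; simp only [mul_assoc]
    _ = _ := by rw [h1, one_mul]

/-- The local pieces of the entire function. -/
noncomputable def rotPiece (A T : E) (b : ℂ) (n k : ℕ) (z : ℂ) : E :=
  b ^ k • (A ^ k * resolvent T (b ^ k * z) * A ^ (n - k))

theorem rotPiece_eq_of_le {A T : E} {b : ℂ} (h : A * T = b • (T * A)) {n j k : ℕ} (hkj : k ≤ j)
    (hjn : j ≤ n) {z : ℂ} (hk : b ^ k * z ∈ resolventSet ℂ T) (hj : b ^ j * z ∈ resolventSet ℂ T) :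
    rotPiece A T b n k z = rotPiece A T b n j z := by
  obtain ⟨i, rfl⟩ := Nat.exists_eq_add_of_le hkj
  obtain ⟨l, rfl⟩ := Nat.exists_eq_add_of_le hjn
  have e : b ^ (k + i) * z = b ^ i * (b ^ k * z) := by rw [pow_add]; ring
  rw [e] at hj
  have := rot_resolvent_intertwine h i hk hj
  unfold rotPiece
  have e1 : k + i + l - k = i + l := by omega
  have e2 : k + i + l - (k + i) = l := by omega
  rw [e, e1, e2, pow_add A i l, ← mul_assoc, mul_assoc (A ^ k), this, mul_smul_comm,
    smul_mul_assoc, smul_smul, pow_add, pow_add]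
  simp only [mul_assoc]

theorem rotPiece_eq {A T : E} {b : ℂ} (h : A * T = b • (T * A)) {n j k : ℕ} (hkn : k ≤ n)
    (hjn : j ≤ n) {z : ℂ} (hk : b ^ k * z ∈ resolventSet ℂ T) (hj : b ^ j * z ∈ resolventSet ℂ T) :
    rotPiece A T b n k z = rotPiece A T b n j z := by
  rcases le_total k j with hh | hh
  · exact rotPiece_eq_of_le h hh hjn hk hj
  · exact (rotPiece_eq_of_le h hh hkn hj hk).symm

theorem rotPiece_differentiableAt {A T : E} {b : ℂ} {n k : ℕ} {z : ℂ}
    (hk : b ^ k * z ∈ resolventSet ℂ T) : DifferentiableAt ℂ (rotPiece A T b n k) z := by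
  have h1 : DifferentiableAt ℂ (resolvent T) (b ^ k * z) :=
    (spectrum.hasDerivAt_resolvent_const_left hk).differentiableAt
  have h2 : DifferentiableAt ℂ (fun z => resolvent T (b ^ k * z)) z :=
    h1.comp z (by fun_prop)
  exact ((h2.const_mul (A ^ k)).mul_const (A ^ (n - k))).const_smul (b ^ k)

theorem rot_pow_eq_zero {A T : E} {b : ℂ} (h : A * T = b • (T * A)) (n : ℕ)
    (hn : ∀ z : ℂ, ∃ k ≤ n, b ^ k * z ∈ resolventSet ℂ T) : A ^ n = 0 := by
  choose κ hκ hκ' using hn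
  set F : ℂ → E := fun z => rotPiece A T b n (κ z) z with hF
  have hFe : ∀ k ≤ n, ∀ z, b ^ k * z ∈ resolventSet ℂ T → F z = rotPiece A T b n k z :=
    fun k hk z hz => rotPiece_eq h (hκ z) hk (hκ' z) hz
  have hd : Differentiable ℂ F := by
    intro z
    refine (rotPiece_differentiableAt (A := A) (n := n) (hκ' z)).congr_of_eventuallyEq ?_
    have ho : IsOpen {y : ℂ | b ^ (κ z) * y ∈ resolventSet ℂ T} :=
      (spectrum.isOpen_resolventSet T).preimage (by fun_prop)
    filter_upwards [ho.mem_nhds (hκ' z)] with y hy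
    exact hFe _ (hκ z) y hy
  have hev : ∀ᶠ z in Bornology.cobounded ℂ, F z = resolvent T z * A ^ n := by
    filter_upwards [spectrum.eventually_isUnit_resolvent (𝕜 := ℂ) T] with z hz
    have hz' := spectrum.isUnit_resolvent.2 hz
    rw [hFe 0 (Nat.zero_le _) z (by simpa using hz')]
    simp [rotPiece]
  have ht : Tendsto F (Filter.cocompact ℂ) (𝓝 0) := by
    rw [← Metric.cobounded_eq_cocompact]
    have := (spectrum.resolvent_tendsto_cobounded (𝕜 := ℂ) T).mul_const (A ^ n)
    rw [zero_mul] at this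
    exact this.congr' (hev.mono fun z hz => hz.symm)
  obtain ⟨z, hz, hz'⟩ := (hev.and (spectrum.eventually_isUnit_resolvent (𝕜 := ℂ) T)).exists
  rw [hd.apply_eq_of_tendsto_cocompact z ht] at hz
  exact (hz'.mul_right_eq_zero).1 hz.symm

theorem rot_exists_orbit {A T : E} {b : ℂ} (h : A * T = b • (T * A)) (hA : ∀ n : ℕ, A ^ n ≠ 0) :
    ∃ z : ℂ, ∀ k : ℕ, b ^ k * z ∈ spectrum ℂ T := by
  have hcl : ∀ n : ℕ, IsClosed {z : ℂ | ∀ k ≤ n, b ^ k * z ∈ spectrum ℂ T} := by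
    intro n
    simp only [Set.ofPred_forall]
    exact isClosed_iInter fun k => isClosed_iInter fun _ =>
      (spectrum.isClosed T).preimage (by fun_prop)
  have := IsCompact.nonempty_iInter_of_sequence_nonempty_isCompact_isClosed
    (fun n : ℕ => {z : ℂ | ∀ k ≤ n, b ^ k * z ∈ spectrum ℂ T})
    (fun n z hz k hk => hz k (by omega))
    (fun n => by
      by_contra hne
      apply hA n
      apply rot_pow_eq_zero h n
      intro z
      by_contra hz
      push Not at hz
      exact hne ⟨z, fun k hk => hz k hk⟩)
    ((spectrum.isCompact T).of_isClosed_subset (hcl 0)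
      (fun z hz => by simpa using hz 0 le_rfl))
    hcl
  obtain ⟨z, hz⟩ := this
  exact ⟨z, fun k => Set.mem_iInter.1 hz k k le_rfl⟩

end Helpers

theorem rot_exists_arg {m : ℂ} (hm : ‖m‖ = 1) :
    ∃ x : ℝ, m = Complex.exp (Complex.I * ((2 * Real.pi * x : ℝ) : ℂ)) := by
  refine ⟨m.arg / (2 * Real.pi), ?_⟩
  have : 2 * Real.pi * (m.arg / (2 * Real.pi)) = m.arg := by
    field_simp
  rw [this]
  have := Complex.norm_mul_exp_arg_mul_I m
  rw [hm] at this
  rw [Complex.ofReal_one, one_mul] at this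
  rw [mul_comm, this]

theorem rot_exp_int (s : ℤ) :
    Complex.exp (Complex.I * ((2 * Real.pi * (s : ℝ) : ℝ) : ℂ)) = 1 := by
  rw [← Complex.exp_int_mul_two_pi_mul_I s]
  congr 1
  push_cast
  ring

theorem rot_dense {b m : ℂ} (hb : ‖b‖ = 1) (hm : ‖m‖ = 1) {n : ℕ} (hn : 0 < n)
    (hbn : ∀ k : ℕ, 0 < k → k ≤ n → b ^ k ≠ 1) :
    ∃ l : ℕ, ‖b ^ l - m‖ ≤ 2 * Real.pi / (n + 1) := by
  obtain ⟨x, hx⟩ := rot_exists_arg hb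
  obtain ⟨y, hy⟩ := rot_exists_arg hm
  obtain ⟨j, k', hk0, hkn, hjk⟩ := Real.exists_int_int_abs_mul_sub_le x hn
  obtain ⟨k, rfl⟩ := Int.eq_ofNat_of_zero_le hk0.le
  set d : ℝ := ((k : ℕ) : ℤ) * x - j with hd
  have hbk : b ^ k = Complex.exp (Complex.I * ((2 * Real.pi * d : ℝ) : ℂ)) := by
    rw [hx, ← Complex.exp_nat_mul]
    rw [← mul_one (Complex.exp (Complex.I * ((2 * Real.pi * d : ℝ) : ℂ))), ← rot_exp_int j,
      ← Complex.exp_add]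
    congr 1
    rw [hd]
    push_cast
    ring
  have hd0 : d ≠ 0 := by
    intro h0
    apply hbn k (by omega) (by omega)
    rw [hbk, h0]; simp
  obtain ⟨s, hs⟩ : ∃ s : ℤ, 0 ≤ (y + s) / d := by
    rcases lt_or_gt_of_ne hd0 with hlt | hgt
    · refine ⟨⌊-y⌋, div_nonneg_of_nonpos ?_ hlt.le⟩
      linarith [Int.floor_le (-y)]
    · refine ⟨⌈-y⌉, div_nonneg ?_ hgt.le⟩
      linarith [Int.le_ceil (-y)]
  set l := ⌊(y + s) / d⌋₊ with hl
  have hl1 : |(l : ℝ) - (y + s) / d| ≤ 1 := by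
    rw [abs_le]
    constructor <;> linarith [Nat.floor_le hs, Nat.lt_floor_add_one ((y + s) / d)]
  have hl2 : |l * d - (y + s)| ≤ |d| := by
    have : l * d - (y + s) = ((l : ℝ) - (y + s) / d) * d := by field_simp
    rw [this, abs_mul]
    exact mul_le_of_le_one_left (abs_nonneg _) hl1
  refine ⟨k * l, ?_⟩
  have key : b ^ (k * l) - m = m *
      (Complex.exp (Complex.I * ((2 * Real.pi * (l * d - (y + s)) : ℝ) : ℂ)) - 1) := by
    rw [mul_sub, mul_one, pow_mul, hbk, ← Complex.exp_nat_mul]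
    congr 1
    rw [hy, ← Complex.exp_add]
    rw [← mul_one (Complex.exp (_ + _)), ← rot_exp_int s, ← Complex.exp_add]
    congr 1
    push_cast
    ring
  rw [key, norm_mul, hm, one_mul]
  refine (Real.norm_exp_I_mul_ofReal_sub_one_le).trans ?_
  rw [Real.norm_eq_abs, abs_mul, abs_of_pos Real.two_pi_pos]
  calc 2 * Real.pi * |l * d - (y + s)| ≤ 2 * Real.pi * (1 / (n + 1)) := by
        gcongr
        exact hl2.trans hjk
    _ = _ := by ring

theorem rot_exists_large {S : Set ℂˣ} (hS : ((Subgroup.closure S : Subgroup ℂˣ) : Set ℂˣ).Infinite)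
    (n : ℕ) : ∃ u ∈ S, ∀ k : ℕ, 0 < k → k ≤ n → u ^ k ≠ 1 := by
  by_contra hcon
  push Not at hcon
  apply hS
  have : NeZero (n.factorial) := ⟨Nat.factorial_ne_zero n⟩
  have hle : Subgroup.closure S ≤ rootsOfUnity n.factorial ℂ := by
    rw [Subgroup.closure_le]
    intro u hu
    obtain ⟨k, hk, hkn, h1⟩ := hcon u hu
    obtain ⟨c, hc⟩ := Nat.dvd_factorial hk hkn
    change u ∈ rootsOfUnity n.factorial ℂ
    rw [mem_rootsOfUnity, hc, pow_mul, h1, one_pow]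
  have hf : Finite (rootsOfUnity n.factorial ℂ) := inferInstance
  exact Set.Finite.subset (s := ((rootsOfUnity n.factorial ℂ : Subgroup ℂˣ) : Set ℂˣ)) hf hle

theorem statement_8 {X : Type*} [NormedAddCommGroup X] [NormedSpace ℂ X] [CompleteSpace X]
    (U V w T : X →L[ℂ] X)
    (hUV : U * V = 1) (hVU : V * U = 1)
    -- U is rotation-like
    (hrot : ∃ (A : X →L[ℂ] X) (γ : ℂ), A ≠ 0 ∧ ‖γ‖ = 1 ∧ γ ≠ 1 ∧ U * A * V = γ • A)
    -- w commutes with every element of 𝒜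
    (hwA : ∀ A ∈ rotOperatorSet U V, w * A = A * w)
    (hT : T = w * U)
    -- T is invertible
    (hTinv : IsUnit T)
    -- (B) for every A ∈ 𝒜 and every n ∈ ℕ, Aⁿ ≠ 0
    (hpow : ∀ A ∈ rotOperatorSet U V, ∀ n : ℕ, 1 ≤ n → A ^ n ≠ 0)
    -- (C) Γ is infinite
    (hΓ : ((Subgroup.closure (rotGammaSet U V) : Subgroup ℂˣ) : Set ℂˣ).Infinite) :
    ∃ t : ℝ, 0 < t ∧ {l : ℂ | ‖l‖ = t} ⊆ spectrum ℂ T := by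
  have step : ∀ n : ℕ, ∃ z ∈ spectrum ℂ T, ∀ m : ℂ, ‖m‖ = 1 →
      ∃ z' ∈ spectrum ℂ T, ‖z' - m * z‖ ≤ 2 * Real.pi / ((n + 1 : ℕ) + 1 : ℝ) * ‖z‖ := by
    intro n
    obtain ⟨u, ⟨hu1, A, hA0, hA⟩, hu⟩ := rot_exists_large hΓ (n + 1)
    have hmem : A ∈ rotOperatorSet U V := ⟨hA0, u, hu1, hA⟩
    have hpow' : ∀ k : ℕ, A ^ k ≠ 0 := by
      intro k
      rcases Nat.eq_zero_or_pos k with rfl | hk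
      · intro h0
        apply hA0
        rw [pow_zero] at h0
        rw [← mul_one A, h0, mul_zero]
      · exact hpow A hmem k hk
    have hUA : U * A = (u : ℂ) • (A * U) := by
      calc U * A = U * A * (V * U) := by rw [hVU, mul_one]
        _ = (U * A * V) * U := by simp only [mul_assoc]
        _ = _ := by rw [hA, smul_mul_assoc]
    have hTA : T * A = (u : ℂ) • (A * T) := by
      rw [hT, mul_assoc, hUA, mul_smul_comm, ← mul_assoc, hwA A hmem, mul_assoc]
    have hAT : A * T = ((u : ℂ)⁻¹) • (T * A) := by
      rw [hTA, smul_smul, inv_mul_cancel₀ u.ne_zero, one_smul]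
    obtain ⟨z, hz⟩ := rot_exists_orbit hAT hpow'
    refine ⟨z, by simpa using hz 0, fun m hm => ?_⟩
    obtain ⟨l, hl⟩ := rot_dense (b := (u : ℂ)⁻¹) (m := m) (by rw [norm_inv, hu1, inv_one]) hm
      (Nat.succ_pos n) (by
        intro k hk hkn h1
        apply hu k hk hkn
        rw [inv_pow, inv_eq_one] at h1
        apply Units.ext
        rw [Units.val_pow_eq_pow_val, h1, Units.val_one])
    refine ⟨_, hz l, ?_⟩
    rw [← sub_mul, norm_mul]
    exact mul_le_mul_of_nonneg_right hl (norm_nonneg _)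
  choose z hz hzm using step
  obtain ⟨a, ha, φ, hφ, hlim⟩ := (spectrum.isCompact (𝕜 := ℂ) T).tendsto_subseq hz
  have ha0 : a ≠ 0 := by
    rintro rfl
    exact (spectrum.zero_mem_iff ℂ).1 ha hTinv
  refine ⟨‖a‖, norm_pos_iff.2 ha0, ?_⟩
  intro c hc
  have hc' : ‖c‖ = ‖a‖ := hc
  have hm1 : ‖c / a‖ = 1 := by rw [norm_div, hc', div_self (norm_ne_zero_iff.2 ha0)]
  choose z' hz' hzz using fun n => hzm n (c / a) hm1
  refine (spectrum.isClosed (𝕜 := ℂ) T).mem_of_tendsto (f := fun n => z' (φ n)) (b := atTop) ?_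
    (Eventually.of_forall fun n => hz' (φ n))
  have hbd : Tendsto (fun n : ℕ => 2 * Real.pi / ((n + 1 : ℕ) + 1 : ℝ)) atTop (𝓝 0) := by
    refine Tendsto.div_atTop tendsto_const_nhds ?_
    exact tendsto_atTop_add_const_right _ _
      (tendsto_natCast_atTop_atTop.comp (tendsto_add_atTop_nat 1))
  have h1 : Tendsto (fun n => z' (φ n) - c / a * z (φ n)) atTop (𝓝 0) := by
    refine squeeze_zero_norm (fun n => hzz (φ n)) ?_
    have := (hbd.comp hφ.tendsto_atTop).mul hlim.norm
    rw [zero_mul] at this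
    exact this
  have h2 := h1.add (hlim.const_mul (c / a))
  rw [zero_add, div_mul_cancel₀ c ha0] at h2
  refine h2.congr fun n => ?_
  simp
end

section
/- Let Ω be an open connected subset of ℂⁿ which contains the origin and satisfies: for every z = (z₁, …, zₙ) ∈ Ω and every (β₁, …, βₙ) with |βⱼ| = 1 for all j, the point (β₁z₁, …, βₙzₙ) lies in Ω. Let α = (α₁, …, αₙ) with |αⱼ| = 1 for all j, let w : Ω → ℂ be analytic and not identically 0, and suppose λ ∈ ℂ and x : Ω → ℂ is analytic, not identically 0, with w(z)·x(α₁z₁, …, αₙzₙ) = λ·x(z) for all z ∈ Ω. Then w(0) ≠ 0, and there exist integers k₁, …, kₙ ≥ 0 such that λ = α₁^{k₁} ⋯ αₙ^{kₙ} · w(0). -/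
open Filter Topology

/-- Identity theorem for holomorphic functions on a connected open subset of a normed space. -/
theorem aux_identity {E : Type*} [NormedAddCommGroup E] [NormedSpace ℂ E] {f : E → ℂ} {U : Set E}
    (hUo : IsOpen U) (hU : IsPreconnected U) (hf : DifferentiableOn ℂ f U)
    {z₀ : E} (h₀ : z₀ ∈ U) (hz : ∀ᶠ z in 𝓝 z₀, f z = 0) : ∀ z ∈ U, f z = 0 := by
  let u := {x | ∀ᶠ z in 𝓝 x, f z = 0}
  suffices main : closure u ∩ U ⊆ u by
    have Uu : U ⊆ u :=
      hU.subset_of_closure_inter_subset isOpen_setOfPred_eventually_nhds ⟨z₀, h₀, hz⟩ main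
    intro z hz
    exact (Uu hz).self_of_nhds
  rintro a ⟨au, aU⟩
  obtain ⟨r, hr, hrU⟩ := Metric.isOpen_iff.1 hUo a aU
  obtain ⟨y, yu, hay⟩ := Metric.mem_closure_iff.1 au r hr
  have hy : y ∈ Metric.ball a r := by rwa [Metric.mem_ball, dist_comm]
  change ∀ᶠ z in 𝓝 a, f z = 0
  filter_upwards [Metric.ball_mem_nhds a hr] with q hq
  let φ : ℂ → E := fun t => y + t • (q - y)
  have hφ : Differentiable ℂ φ := by fun_prop
  let S : Set ℂ := φ ⁻¹' Metric.ball a r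
  have hSo : IsOpen S := Metric.isOpen_ball.preimage hφ.continuous
  have hSc : Convex ℝ S := by
    intro s hs t ht c d hc hd hcd
    have : φ (c • s + d • t) = c • φ s + d • φ t := by
      have hy : y = c • y + d • y := by rw [← add_smul, hcd, one_smul]
      simp only [φ, add_smul, smul_add, smul_assoc]
      nth_rewrite 1 [hy]
      abel
    change φ (c • s + d • t) ∈ Metric.ball a r
    rw [this]
    exact convex_ball a r hs ht hc hd hcd
  have hg : AnalyticOnNhd ℂ (fun t => f (φ t)) S :=
    ((hf.mono hrU).comp hφ.differentiableOn (fun t ht => ht)).analyticOnNhd hSo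
  have h0S : (0 : ℂ) ∈ S := by simpa [S, φ] using hy
  have h1S : (1 : ℂ) ∈ S := by simpa [S, φ] using hq
  have hev : (fun t => f (φ t)) =ᶠ[𝓝 0] 0 := by
    have : Tendsto φ (𝓝 0) (𝓝 y) := by
      have := hφ.continuous.tendsto 0
      simpa [φ] using this
    exact this.eventually yu
  have := hg.eqOn_zero_of_preconnected_of_eventuallyEq_zero hSc.isPreconnected h0S hev h1S
  simpa [φ] using this

theorem aux_cons_norm {n : ℕ} {s : ℂ} {z : Fin n → ℂ} {r : ℝ} (hs : ‖s‖ < r) (hz : ‖z‖ < r) :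
    ‖(Fin.cons s z : Fin (n + 1) → ℂ)‖ < r := by
  rw [pi_norm_lt_iff ((norm_nonneg _).trans_lt hs)]
  intro i
  refine Fin.cases ?_ (fun j => ?_) i
  · simpa
  · simpa using (norm_le_pi_norm z j).trans_lt hz

/-- Cauchy coefficients in the first variable are holomorphic in the others. -/
theorem aux_param {n : ℕ} {f : (Fin (n + 1) → ℂ) → ℂ} {r ρ : ℝ} (hρ : 0 < ρ) (hρr : ρ < r)
    (hf : DifferentiableOn ℂ f (Metric.ball 0 r)) (c : ℝ → ℂ) (hc : Continuous c) :
    DifferentiableOn ℂ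
      (fun z : Fin n → ℂ => ∫ θ in (0:ℝ)..2 * Real.pi,
        c θ * f (Fin.cons (circleMap 0 ρ θ) z)) (Metric.ball 0 r) := by
  intro z₀ hz₀
  rw [mem_ball_zero_iff] at hz₀
  let L : (Fin n → ℂ) →L[ℂ] (Fin (n + 1) → ℂ) :=
    ContinuousLinearMap.pi (Fin.cons 0 (fun j => ContinuousLinearMap.proj j))
  have hL : ∀ s z, (Fin.cons s z : Fin (n + 1) → ℂ) = Fin.cons s 0 + L z := by
    intro s z
    ext i
    refine Fin.cases ?_ (fun j => ?_) i <;> simp [L]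
  have hcm : Continuous (circleMap 0 ρ) := continuous_circleMap 0 ρ
  have hcn : ∀ θ, ‖circleMap 0 ρ θ‖ = ρ := by intro θ; simp [abs_of_pos hρ]
  obtain ⟨r', h1, h2⟩ := exists_between (max_lt hρr hz₀)
  have h1a : ρ < r' := (le_max_left _ _).trans_lt h1
  have h1b : ‖z₀‖ < r' := (le_max_right _ _).trans_lt h1
  obtain ⟨r'', h3, h4⟩ := exists_between h2
  have hsub : Metric.closedBall (0 : Fin (n + 1) → ℂ) r'' ⊆ Metric.ball 0 r :=
    Metric.closedBall_subset_ball h4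
  obtain ⟨M, hM⟩ := (isCompact_closedBall (0 : Fin (n + 1) → ℂ) r'').exists_bound_of_continuousOn
    (hf.continuousOn.mono hsub)
  obtain ⟨C, hC⟩ := (isCompact_Icc (a := (0:ℝ)) (b := 2 * Real.pi)).exists_bound_of_continuousOn
    hc.continuousOn
  have hmem : ∀ θ, ∀ z : Fin n → ℂ, ‖z‖ < r' →
      (Fin.cons (circleMap 0 ρ θ) z : Fin (n + 1) → ℂ) ∈ Metric.ball 0 r' := by
    intro θ z hz
    rw [mem_ball_zero_iff]
    exact aux_cons_norm (by rwa [hcn]) hz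
  have hdiff : ∀ θ, HasFDerivAt (fun z : Fin n → ℂ => c θ * f (Fin.cons (circleMap 0 ρ θ) z))
      (c θ • (fderiv ℂ f (Fin.cons (circleMap 0 ρ θ) z₀)).comp L) z₀ := by
    intro θ
    have hd : DifferentiableAt ℂ f (Fin.cons (circleMap 0 ρ θ) z₀) :=
      hf.differentiableAt (Metric.isOpen_ball.mem_nhds
        (Metric.ball_subset_ball h2.le (hmem θ z₀ h1b)))
    have hk : HasFDerivAt (fun z : Fin n → ℂ => (Fin.cons (circleMap 0 ρ θ) z : Fin (n + 1) → ℂ))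
        L z₀ := by
      have hL' : (fun z : Fin n → ℂ => (Fin.cons (circleMap 0 ρ θ) z : Fin (n + 1) → ℂ))
          = fun z => Fin.cons (circleMap 0 ρ θ) 0 + L z := funext fun z => hL _ z
      rw [hL']
      exact L.hasFDerivAt.const_add _
    exact (HasFDerivAt.comp z₀ hd.hasFDerivAt hk).const_mul (c θ)
  have hcont : ∀ z : Fin n → ℂ, ‖z‖ < r' →
      Continuous (fun θ => c θ * f (Fin.cons (circleMap 0 ρ θ) z)) := by
    intro z hz
    refine hc.mul ?_
    refine (hf.continuousOn.mono (Metric.ball_subset_ball h2.le)).comp_continuous ?_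
      (fun θ => hmem θ z hz)
    refine continuous_pi fun i => ?_
    refine Fin.cases ?_ (fun j => ?_) i
    · simpa using hcm
    · simpa using continuous_const
  have hs : {z : Fin n → ℂ | ‖z‖ < r'} ∩ Metric.ball z₀ (r'' - r') ∈ 𝓝 z₀ :=
    inter_mem ((isOpen_lt continuous_norm continuous_const).mem_nhds h1b)
      (Metric.ball_mem_nhds _ (by linarith))
  simp_rw [intervalIntegral.integral_of_le Real.two_pi_pos.le]
  refine DifferentiableAt.differentiableWithinAt (HasFDerivAt.differentiableAt
    (hasFDerivAt_integral_of_dominated_loc_of_lip' (𝕜 := ℂ)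
      (bound := fun _ => C * ((2 * M) / (r'' - r'))) hs ?_ ?_ ?_ ?_ ?_
      (Eventually.of_forall hdiff)).2)
  · intro z hz
    exact (hcont z hz.1).aestronglyMeasurable
  · exact (hcont z₀ h1b).integrableOn_Ioc
  · have hm : Measurable fun θ => fderiv ℂ f (Fin.cons (circleMap 0 ρ θ) z₀) := by
      refine (measurable_fderiv ℂ f).comp ?_
      refine measurable_pi_lambda _ fun i => ?_
      refine Fin.cases ?_ (fun j => ?_) i
      · simpa using hcm.measurable
      · simp
    have h1 := hm.stronglyMeasurable.aestronglyMeasurable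
      (μ := (MeasureTheory.volume.restrict (Set.Ioc 0 (2 * Real.pi))))
    have h2 : Continuous fun A : (Fin (n + 1) → ℂ) →L[ℂ] ℂ => A.comp L := by fun_prop
    exact hc.aestronglyMeasurable.smul (h2.comp_aestronglyMeasurable h1)
  · refine (MeasureTheory.ae_restrict_iff' measurableSet_Ioc).2 (Eventually.of_forall ?_)
    intro θ hθ z hz
    have hp := hmem θ z₀ h1b
    set p : Fin (n + 1) → ℂ := Fin.cons (circleMap 0 ρ θ) z₀ with hpdef
    have hpn : ‖p‖ < r' := by simpa using hp
    have hb : Metric.ball p (r'' - r') ⊆ Metric.closedBall 0 r'' := by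
      intro q hq
      rw [mem_closedBall_zero_iff]
      rw [mem_ball_iff_norm] at hq
      have := norm_le_norm_add_norm_sub' q p
      linarith
    have hdd : dist (Fin.cons (circleMap 0 ρ θ) z : Fin (n + 1) → ℂ) p ≤ dist z z₀ := by
      rw [dist_pi_le_iff dist_nonneg]
      intro i
      refine Fin.cases ?_ (fun j => ?_) i
      · simp [hpdef]
      · simpa [hpdef] using dist_le_pi_dist z z₀ j
    have hpos : 0 < r'' - r' := by linarith
    have key := Complex.dist_le_div_mul_dist_of_mapsTo_ball (f := f) (c := p)
      (R₁ := r'' - r') (R₂ := 2 * M) (z := Fin.cons (circleMap 0 ρ θ) z)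
      (hf.mono (hb.trans hsub)) (by
        intro q hq
        rw [mem_closedBall_iff_norm]
        have a1 := hM q (hb hq)
        have a2 := hM p (hb (Metric.mem_ball_self hpos))
        have := norm_sub_le (f q) (f p)
        linarith) (by
        rw [Metric.mem_ball]
        exact hdd.trans_lt hz.2)
    have hM0 : 0 ≤ M := (norm_nonneg _).trans (hM p (hb (Metric.mem_ball_self hpos)))
    have hC' := hC θ ⟨hθ.1.le, hθ.2⟩
    rw [← mul_sub, norm_mul, mul_assoc, ← dist_eq_norm, ← dist_eq_norm]
    have : dist (f (Fin.cons (circleMap 0 ρ θ) z)) (f p) ≤ 2 * M / (r'' - r') * dist z z₀ :=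
      key.trans (by gcongr)
    exact mul_le_mul hC' this dist_nonneg ((norm_nonneg _).trans hC')
  · exact MeasureTheory.integrable_const _

theorem aux_factor {g : ℂ → ℂ} {p : FormalMultilinearSeries ℂ ℂ ℂ} (hp : HasFPowerSeriesAt g p 0)
    (m : ℕ) (hm : ∀ j < m, p.coeff j = 0) :
    ∃ h : ℂ → ℂ, ContinuousAt h 0 ∧ h 0 = p.coeff m ∧ ∀ s, g s = s ^ m * h s := by
  have H := fun j => hp.has_fpower_series_iterate_dslope_fslope j
  have H0 : ∀ j, (Function.swap dslope 0)^[j] g 0 = p.coeff j := by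
    intro j
    rw [← (H j).coeff_zero 1]
    have := FormalMultilinearSeries.coeff_iterate_fslope (p := p) j 0
    rw [zero_add] at this
    rw [← this]
    rfl
  refine ⟨(Function.swap dslope 0)^[m] g, (H m).continuousAt, H0 m, ?_⟩
  induction m with
  | zero => intro s; simp
  | succ m ih =>
    intro s
    rw [ih (fun j hj => hm j (by omega)) s, Function.iterate_succ_apply', pow_succ, mul_assoc]
    congr 1
    have := sub_smul_dslope ((Function.swap dslope 0)^[m] g) 0 s
    rw [H0 m, hm m (by omega)] at this
    simpa using this.symm

theorem aux_main (l : ℂ) : ∀ (n : ℕ) (r : ℝ) (α : Fin n → ℂ) (w x : (Fin n → ℂ) → ℂ),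
    0 < r → (∀ j, ‖α j‖ = 1) → ContinuousOn w (Metric.ball 0 r) →
    DifferentiableOn ℂ x (Metric.ball 0 r) → (∃ z ∈ Metric.ball 0 r, x z ≠ 0) →
    (∀ z ∈ Metric.ball 0 r, w z * x (fun j => α j * z j) = l * x z) →
    ∃ k : Fin n → ℕ, l = (∏ j : Fin n, α j ^ k j) * w 0 := by
  intro n
  induction n with
  | zero =>
    rintro r α w x hr - - - ⟨z, hz, hxz⟩ heq
    refine ⟨0, ?_⟩
    have h := heq z hz
    have e1 : (fun j => α j * z j) = z := Subsingleton.elim _ _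
    have e2 : z = 0 := Subsingleton.elim _ _
    rw [e1] at h
    have := mul_right_cancel₀ hxz h
    rw [e2] at this
    rw [this, Finset.univ_eq_empty, Finset.prod_empty, one_mul]
  | succ n ih =>
    rintro r α w x hr hα hw hx ⟨z, hz, hxz⟩ heq
    let α' : Fin n → ℂ := fun j => α j.succ
    let z' : Fin n → ℂ := fun j => z j.succ
    have hzc : z = Fin.cons (z 0) z' := (Fin.cons_self_tail z).symm
    rw [mem_ball_zero_iff] at hz
    have hz0 : ‖z 0‖ < r := (norm_le_pi_norm z 0).trans_lt hz
    have hz' : ‖z'‖ < r := by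
      rw [pi_norm_lt_iff hr]
      exact fun j => (norm_le_pi_norm z j.succ).trans_lt hz
    obtain ⟨ρ, hρ0, hρr⟩ := exists_between hz0
    have hρ : 0 < ρ := (norm_nonneg _).trans_lt hρ0
    lift ρ to NNReal using hρ.le
    let p : (Fin n → ℂ) → FormalMultilinearSeries ℂ ℂ ℂ :=
      fun y => cauchyPowerSeries (fun s => x (Fin.cons s y)) 0 ρ
    have hp : ∀ y : Fin n → ℂ, ‖y‖ < r →
        HasFPowerSeriesOnBall (fun s => x (Fin.cons s y)) (p y) 0 ρ := by
      intro y hy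
      refine DifferentiableOn.hasFPowerSeriesOnBall ?_ (by exact_mod_cast hρ)
      refine hx.comp (f := fun s : ℂ => (Fin.cons s y : Fin (n + 1) → ℂ)) ?_ ?_
      · refine Differentiable.differentiableOn ?_
        refine differentiable_pi.2 fun i => ?_
        refine Fin.cases ?_ (fun j => ?_) i
        · simp
        · simp
      · intro s hs
        rw [mem_closedBall_zero_iff] at hs
        rw [mem_ball_zero_iff]
        exact aux_cons_norm (hs.trans_lt hρr) hy
    have hex : ∃ m, ∃ y : Fin n → ℂ, ‖y‖ < r ∧ (p y).coeff m ≠ 0 := by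
      by_contra hcon
      push Not at hcon
      have hs := (hp z' hz').hasSum (y := z 0) (by
        simpa only [Metric.mem_eball, edist_zero_right, enorm_lt_coe] using! hρ0)
      have h00 : (fun m : ℕ => (p z' m) fun _ => z 0) = fun _ => 0 := by
        ext m
        rw [FormalMultilinearSeries.apply_eq_pow_smul_coeff, hcon m z' hz', smul_zero]
      rw [h00, zero_add, ← hzc] at hs
      exact hxz (hs.unique hasSum_zero)
    classical
    let m := Nat.find hex
    obtain ⟨y₀, hy₀, hy₀m⟩ := Nat.find_spec hex
    have hmin : ∀ j < m, ∀ y : Fin n → ℂ, ‖y‖ < r → (p y).coeff j = 0 := by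
      intro j hj y hy
      have := Nat.find_min hex hj
      push Not at this
      exact this y hy
    have hrot : ∀ y : Fin n → ℂ, ‖y‖ < r → ‖fun j => α' j * y j‖ < r := by
      intro y hy
      rw [pi_norm_lt_iff hr]
      intro j
      rw [norm_mul, hα j.succ, one_mul]
      exact (norm_le_pi_norm y j).trans_lt hy
    have hα0 : α 0 ≠ 0 := by
      intro h
      have := hα 0
      simp [h] at this
    have hA : ContinuousOn (fun y : Fin n → ℂ => w (Fin.cons 0 y) * α 0 ^ m)
        (Metric.ball 0 r) := by
      refine ContinuousOn.mul ?_ continuousOn_const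
      refine hw.comp (f := fun y : Fin n → ℂ => (Fin.cons 0 y : Fin (n + 1) → ℂ)) ?_ ?_
      · refine Continuous.continuousOn ?_
        refine continuous_pi fun i => ?_
        refine Fin.cases ?_ (fun j => ?_) i
        · simpa using continuous_const
        · simpa using continuous_apply j
      · intro y hy
        rw [mem_ball_zero_iff] at hy ⊢
        exact aux_cons_norm (by simpa using hr) hy
    have hB : DifferentiableOn ℂ (fun y : Fin n → ℂ => (p y).coeff m) (Metric.ball 0 r) := by
      have hcm0 : ∀ θ, circleMap 0 (ρ : ℝ) θ ≠ 0 := fun θ => circleMap_ne_center hρ.ne'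
      have hcm : Continuous (circleMap 0 (ρ : ℝ)) := continuous_circleMap 0 ρ
      have := (aux_param hρ hρr hx (fun θ => (circleMap 0 (ρ : ℝ) θ * Complex.I) *
        ((1 / circleMap 0 (ρ : ℝ) θ) ^ m * (circleMap 0 (ρ : ℝ) θ)⁻¹))
        (by fun_prop (disch := assumption))).const_mul (2 * Real.pi * Complex.I : ℂ)⁻¹
      refine this.congr fun y hy => ?_
      have := cauchyPowerSeries_apply (fun s => x (Fin.cons s y)) 0 ρ m 1
      rw [FormalMultilinearSeries.apply_eq_pow_smul_coeff] at this
      simp only [one_pow, one_mul, circleIntegral, deriv_circleMap, smul_eq_mul, sub_zero] at this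
      simp only [p, this]
      simp only [mul_assoc]
    have hC : ∀ y ∈ Metric.ball (0 : Fin n → ℂ) r,
        w (Fin.cons 0 y) * α 0 ^ m * (p (fun j => α' j * y j)).coeff m
          = l * (p y).coeff m := by
      intro y hy
      rw [mem_ball_zero_iff] at hy
      obtain ⟨h, hh, hh0, hg⟩ := aux_factor (hp y hy).hasFPowerSeriesAt m
        (fun j hj => hmin j hj y hy)
      obtain ⟨h', hh', hh0', hg'⟩ := aux_factor (hp _ (hrot y hy)).hasFPowerSeriesAt m
        (fun j hj => hmin j hj _ (hrot y hy))
      rw [← hh0, ← hh0']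
      have hwc : ContinuousAt (fun s : ℂ => w (Fin.cons s y)) 0 := by
        refine ContinuousAt.comp (f := fun s : ℂ => (Fin.cons s y : Fin (n + 1) → ℂ)) ?_ ?_
        · refine hw.continuousAt (Metric.isOpen_ball.mem_nhds ?_)
          rw [mem_ball_zero_iff]
          exact aux_cons_norm (by simpa using hr) hy
        · refine continuousAt_pi.2 fun i => ?_
          refine Fin.cases ?_ (fun j => ?_) i
          · exact continuousAt_id
          · simpa using continuousAt_const
      have hh'2 : ContinuousAt (fun s : ℂ => h' (α 0 * s)) 0 := by
        refine ContinuousAt.comp (f := fun s : ℂ => α 0 * s) ?_ (by fun_prop)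
        simpa using hh'
      have t1 : Tendsto (fun s : ℂ => w (Fin.cons s y) * α 0 ^ m * h' (α 0 * s)) (𝓝[≠] 0)
          (𝓝 (w (Fin.cons 0 y) * α 0 ^ m * h' 0)) := by
        have : Tendsto (fun s : ℂ => w (Fin.cons s y) * α 0 ^ m * h' (α 0 * s)) (𝓝 0)
            (𝓝 (w (Fin.cons 0 y) * α 0 ^ m * h' (α 0 * 0))) :=
          (hwc.tendsto.mul_const (α 0 ^ m)).mul hh'2.tendsto
        rw [mul_zero] at this
        exact this.mono_left nhdsWithin_le_nhds
      have t2 : Tendsto (fun s : ℂ => l * h s) (𝓝[≠] 0) (𝓝 (l * h 0)) :=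
        (hh.tendsto.const_mul l).mono_left nhdsWithin_le_nhds
      refine tendsto_nhds_unique_of_eventuallyEq t1 t2 ?_
      filter_upwards [self_mem_nhdsWithin,
        mem_nhdsWithin_of_mem_nhds (Metric.ball_mem_nhds (0:ℂ) hr)] with s hs0 hsr
      rw [mem_ball_zero_iff] at hsr
      have e := heq (Fin.cons s y) (by
        rw [mem_ball_zero_iff]
        exact aux_cons_norm hsr hy)
      have e1 : (fun j => α j * (Fin.cons s y : Fin (n + 1) → ℂ) j)
          = Fin.cons (α 0 * s) (fun j => α' j * y j) := by
        ext i
        refine Fin.cases ?_ (fun j => ?_) i <;> simp [α']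
      have g1 := hg s
      have g2 := hg' (α 0 * s)
      rw [e1, g1, g2] at e
      refine mul_left_cancel₀ (pow_ne_zero m (show s ≠ 0 from hs0)) ?_
      rw [mul_pow] at e
      linear_combination e
    obtain ⟨k, hk⟩ := ih r α' (fun y => w (Fin.cons 0 y) * α 0 ^ m) (fun y => (p y).coeff m) hr
      (fun j => hα _) hA hB ⟨y₀, by simpa using hy₀, hy₀m⟩ hC
    refine ⟨Fin.cons m k, ?_⟩
    rw [hk, Fin.prod_univ_succ]
    have : (Fin.cons 0 0 : Fin (n + 1) → ℂ) = 0 := by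
      ext i
      refine Fin.cases ?_ (fun j => ?_) i <;> simp
    rw [this]
    simp only [Fin.cons_zero, Fin.cons_succ, α']
    ring

theorem statement_16 (n : ℕ) (Ω : Set (Fin n → ℂ)) (hΩo : IsOpen Ω) (hΩc : IsConnected Ω)
    (h0 : (0 : Fin n → ℂ) ∈ Ω)
    -- Ω is closed under componentwise multiplication by unimodular scalars
    (hΩrot : ∀ z ∈ Ω, ∀ β : Fin n → ℂ, (∀ j, ‖β j‖ = 1) → (fun j => β j * z j) ∈ Ω)
    (α : Fin n → ℂ) (hα : ∀ j, ‖α j‖ = 1)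
    (w : (Fin n → ℂ) → ℂ) (hwa : DifferentiableOn ℂ w Ω) (hw0 : ∃ z ∈ Ω, w z ≠ 0)
    (l : ℂ) (x : (Fin n → ℂ) → ℂ) (hxa : DifferentiableOn ℂ x Ω) (hx0 : ∃ z ∈ Ω, x z ≠ 0)
    (heig : ∀ z ∈ Ω, w z * x (fun j => α j * z j) = l * x z) :
    w 0 ≠ 0 ∧ ∃ k : Fin n → ℕ, l = (∏ j : Fin n, α j ^ k j) * w 0 := by
  obtain ⟨r, hr, hrΩ⟩ := Metric.isOpen_iff.1 hΩo 0 h0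
  obtain ⟨a, haΩ, hxa0⟩ := hx0
  have hα0 : ∀ j, α j ≠ 0 := by
    intro j h
    have := hα j
    simp [h] at this
  have hl : l ≠ 0 := by
    rintro rfl
    obtain ⟨b, hbΩ, hwb⟩ := hw0
    have hd : DifferentiableOn ℂ (fun z : Fin n → ℂ => x (fun j => α j * z j)) Ω := by
      refine hxa.comp (f := fun z : Fin n → ℂ => (fun j => α j * z j)) ?_
        (fun z hz => hΩrot z hz α hα)
      fun_prop
    have hev : ∀ᶠ z in 𝓝 b, x (fun j => α j * z j) = 0 := by
      have hc : ContinuousAt w b := hwa.continuousOn.continuousAt (hΩo.mem_nhds hbΩ)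
      filter_upwards [hc.eventually_ne hwb, hΩo.mem_nhds hbΩ] with z hz hzΩ
      have := heig z hzΩ
      rw [zero_mul] at this
      exact (mul_eq_zero.1 this).resolve_left hz
    have hall := aux_identity hΩo hΩc.isPreconnected hd hbΩ hev
    have ha' := hall _ (hΩrot a haΩ (fun j => (α j)⁻¹) (fun j => by simp [hα j]))
    apply hxa0
    convert ha' using 2
    ext j
    rw [mul_inv_cancel_left₀ (hα0 j)]
  have hnz : ∃ z ∈ Metric.ball 0 r, x z ≠ 0 := by
    by_contra hcon
    push Not at hcon
    exact hxa0 (aux_identity hΩo hΩc.isPreconnected hxa h0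
      (mem_of_superset (Metric.ball_mem_nhds 0 hr) hcon) a haΩ)
  obtain ⟨k, hk⟩ := aux_main l n r α w x hr hα (hwa.continuousOn.mono hrΩ) (hxa.mono hrΩ) hnz
    (fun z hz => heig z (hrΩ hz))
  refine ⟨fun hw => hl ?_, k, hk⟩
  rw [hk, hw, mul_zero]
end
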